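/- Let η ∈ (0,1), T > 0, let S* : [0,T] → ℝ be integrable, let (Δ_n) be a sequence of positive reals with Δ_n → 0, and let S_n : [0,T] → ℝ be measurable functions converging to S* uniformly on [0,T]. Then sup_{t ∈ [0,T]} | ∫₀ᵗ S_n(τ) u_{Δ_n}(τ) dτ − η ∫₀ᵗ S*(τ) dτ | → 0 as n → ∞; i.e., when the effective supply converges uniformly to a limit supply, the on-and-off downstream boundary condition converges uniformly to the continuum downstream boundary condition as the signal cycles tend to zero. -/

import Mathlib

open MeasureTheory Filter

/-- The Δ-periodic on-and-off traffic signal with split η: equal to 1 (green)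
during the first ηΔ of each cycle of length Δ, and 0 (red) otherwise. -/
noncomputable def uOnOff (Δ η τ : ℝ) : ℝ :=
  if τ - Δ * (⌊τ / Δ⌋ : ℝ) < η * Δ then 1 else 0

section OnOffSignal

variable {Δ η τ : ℝ}

lemma uOnOff_eq_ite_fract (hΔ : 0 < Δ) :
    uOnOff Δ η τ = if Int.fract (τ / Δ) < η then 1 else 0 := by
  have h : τ - Δ * (⌊τ / Δ⌋ : ℝ) = Int.fract (τ / Δ) * Δ := by
    rw [Int.fract]; field_simp
  simp only [uOnOff, h, mul_lt_mul_iff_left₀ hΔ]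

lemma measurable_uOnOff (Δ η : ℝ) : Measurable (uOnOff Δ η) := by
  unfold uOnOff
  refine Measurable.ite (measurableSet_lt ?_ measurable_const) measurable_const measurable_const
  fun_prop

lemma abs_uOnOff_le_one : |uOnOff Δ η τ| ≤ 1 := by
  unfold uOnOff; split_ifs <;> simp

lemma abs_uOnOff_sub_le_one (hη : η ∈ Set.Ioo (0 : ℝ) 1) : |uOnOff Δ η τ - η| ≤ 1 := by
  obtain ⟨h0, h1⟩ := hη
  unfold uOnOff
  split_ifs <;> rw [abs_le] <;> constructor <;> linarith

/-- The `Δ`-periodic primitive, vanishing at `0`, of the centred signal `uOnOff Δ η - η`. -/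
noncomputable def onOffPrimitive (Δ η τ : ℝ) : ℝ :=
  Δ * (min (Int.fract (τ / Δ)) η - η * Int.fract (τ / Δ))

lemma onOffPrimitive_zero (hη : 0 ≤ η) : onOffPrimitive Δ η 0 = 0 := by
  simp [onOffPrimitive, hη]

lemma abs_onOffPrimitive_le (hΔ : 0 ≤ Δ) (hη : η ∈ Set.Ioo (0 : ℝ) 1) :
    |onOffPrimitive Δ η τ| ≤ Δ := by
  obtain ⟨h0, h1⟩ := hη
  rw [onOffPrimitive, abs_mul, abs_of_nonneg hΔ]
  refine mul_le_of_le_one_right hΔ ?_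
  have hx0 := Int.fract_nonneg (τ / Δ)
  have hx1 := (Int.fract_lt_one (τ / Δ)).le
  generalize Int.fract (τ / Δ) = x at *
  rw [abs_le]
  constructor
  · have : 0 ≤ min x η := le_min hx0 h0.le
    nlinarith
  · have : min x η ≤ x := min_le_left _ _
    nlinarith

lemma continuous_onOffPrimitive (hη : η ∈ Set.Ioo (0 : ℝ) 1) :
    Continuous (onOffPrimitive Δ η) := by
  have h : Continuous ((fun x : ℝ => min x η - η * x) ∘ Int.fract) :=
    ContinuousOn.comp_fract'' (by fun_prop) (by simp [hη.1.le, hη.2.le])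
  exact continuous_const.mul (h.comp (continuous_id.div_const Δ))

lemma hasDerivWithinAt_onOffPrimitive (hΔ : 0 < Δ) :
    HasDerivWithinAt (onOffPrimitive Δ η) (uOnOff Δ η τ - η) (Set.Ioi τ) τ := by
  have hfloor : ∀ᶠ x in nhdsWithin τ (Set.Ici τ), ⌊x / Δ⌋ = ⌊τ / Δ⌋ := by
    have ht : Tendsto (fun x : ℝ => x / Δ) (nhdsWithin τ (Set.Ici τ))
        (nhdsWithin (τ / Δ) (Set.Ici (τ / Δ))) :=
      tendsto_nhdsWithin_of_tendsto_nhds_of_eventually_within _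
        ((continuous_id.div_const Δ).continuousAt.tendsto.mono_left nhdsWithin_le_nhds)
        (eventually_nhdsWithin_of_forall fun x hx => div_le_div_of_nonneg_right hx hΔ.le)
    exact ht.eventually (tendsto_pure.1 (tendsto_floor_right_pure_floor (τ / Δ)))
  set k : ℝ := (⌊τ / Δ⌋ : ℝ) with hk
  have hlin : HasDerivAt (fun x : ℝ => x / Δ - k) (1 / Δ) τ :=
    ((hasDerivAt_id τ).div_const Δ).sub_const k
  have hcont : Tendsto (fun x : ℝ => x / Δ - k) (nhdsWithin τ (Set.Ici τ)) (nhds (τ / Δ - k)) :=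
    hlin.continuousAt.tendsto.mono_left nhdsWithin_le_nhds
  refine HasDerivWithinAt.mono ?_ Set.Ioi_subset_Ici_self
  rw [uOnOff_eq_ite_fract hΔ, Int.fract, ← hk]
  split_ifs with h
  · have hd : HasDerivWithinAt (fun x : ℝ => Δ * ((x / Δ - k) - η * (x / Δ - k))) (1 - η)
        (Set.Ici τ) τ := by
      refine (((hlin.sub (hlin.const_mul η)).const_mul Δ).congr_deriv ?_).hasDerivWithinAt
      field_simp
    refine hd.congr_of_eventuallyEq_of_mem ?_ Set.self_mem_Ici
    filter_upwards [hfloor, hcont.eventually_lt_const h] with x hx hx'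
    rw [onOffPrimitive, Int.fract, hx, ← hk, min_eq_left hx'.le]
  · have hd : HasDerivWithinAt (fun x : ℝ => Δ * (η - η * (x / Δ - k))) (0 - η)
        (Set.Ici τ) τ := by
      refine ((((hlin.const_mul η).const_sub η).const_mul Δ).congr_deriv ?_).hasDerivWithinAt
      field_simp
      ring
    refine hd.congr_of_eventuallyEq_of_mem ?_ Set.self_mem_Ici
    filter_upwards [hfloor, self_mem_nhdsWithin] with x hx hx'
    have hle : τ / Δ ≤ x / Δ := div_le_div_of_nonneg_right hx' hΔ.le
    rw [onOffPrimitive, Int.fract, hx, ← hk, min_eq_right (by linarith)]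

lemma MeasureTheory.IntegrableOn.intervalIntegrable_of_mem_Icc {f : ℝ → ℝ} {T t : ℝ}
    (hf : IntegrableOn f (Set.Icc 0 T)) (ht : t ∈ Set.Icc 0 T) :
    IntervalIntegrable f volume 0 t :=
  (intervalIntegrable_iff_integrableOn_Icc_of_le ht.1).2
    (hf.mono_set (Set.Icc_subset_Icc_right ht.2))

lemma MeasureTheory.IntegrableOn.mul_uOnOff {f : ℝ → ℝ} {s : Set ℝ} (hf : IntegrableOn f s) :
    IntegrableOn (fun τ => f τ * uOnOff Δ η τ) s :=
  Integrable.mul_bdd hf (measurable_uOnOff Δ η).aestronglyMeasurable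
    (ae_of_all _ fun _ => abs_uOnOff_le_one)

lemma MeasureTheory.IntegrableOn.mul_uOnOff_sub {f : ℝ → ℝ} {s : Set ℝ}
    (hf : IntegrableOn f s) :
    IntegrableOn (fun τ => f τ * (uOnOff Δ η τ - η)) s := by
  simp only [mul_sub]
  exact hf.mul_uOnOff.sub (hf.mul_const η)

lemma abs_integral_mul_uOnOff_sub_le_of_contDiff {f : ℝ → ℝ} (hf : ContDiff ℝ 1 f) {C t : ℝ}
    (ht : 0 ≤ t) (hC : ∀ x ∈ Set.Icc 0 t, |f x| ≤ C) (hC' : ∀ x ∈ Set.Icc 0 t, |deriv f x| ≤ C)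
    (hΔ : 0 < Δ) (hη : η ∈ Set.Ioo (0 : ℝ) 1) :
    |∫ τ in (0 : ℝ)..t, f τ * (uOnOff Δ η τ - η)| ≤ C * (1 + t) * Δ := by
  have hf' : Continuous (deriv f) := hf.continuous_deriv le_rfl
  have hC0 : 0 ≤ C := (abs_nonneg _).trans (hC 0 (Set.left_mem_Icc.2 ht))
  have hu : IntervalIntegrable (fun τ => uOnOff Δ η τ - η) volume 0 t := by
    have h : IntegrableOn (fun _ : ℝ => (1 : ℝ)) (Set.Icc 0 t) := by simp
    refine IntegrableOn.intervalIntegrable_of_mem_Icc ?_ (Set.right_mem_Icc.2 ht)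
    simpa using h.mul_uOnOff_sub (Δ := Δ) (η := η)
  rw [intervalIntegral.integral_mul_deriv_eq_deriv_mul_of_hasDeriv_right
    hf.continuous.continuousOn (continuous_onOffPrimitive (Δ := Δ) hη).continuousOn
    (fun x _ => ((hf.differentiable one_ne_zero) x).hasDerivAt.hasDerivWithinAt)
    (fun x _ => hasDerivWithinAt_onOffPrimitive hΔ)
    (hf'.intervalIntegrable _ _) hu, onOffPrimitive_zero hη.1.le, mul_zero, sub_zero]
  have hbdry : |f t * onOffPrimitive Δ η t| ≤ C * Δ := by
    rw [abs_mul]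
    exact mul_le_mul (hC t (Set.right_mem_Icc.2 ht)) (abs_onOffPrimitive_le hΔ.le hη)
      (abs_nonneg _) hC0
  have hint : |∫ x in (0 : ℝ)..t, deriv f x * onOffPrimitive Δ η x| ≤ C * Δ * |t - 0| := by
    rw [← Real.norm_eq_abs]
    refine intervalIntegral.norm_integral_le_of_norm_le_const fun x hx => ?_
    rw [Set.uIoc_of_le ht] at hx
    rw [norm_mul]
    exact mul_le_mul (hC' x (Set.Ioc_subset_Icc_self hx)) (abs_onOffPrimitive_le hΔ.le hη)
      (abs_nonneg _) hC0
  rw [sub_zero, abs_of_nonneg ht] at hint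
  calc _ ≤ _ := abs_sub _ _
    _ ≤ C * Δ + C * Δ * t := add_le_add hbdry hint
    _ = C * (1 + t) * Δ := by ring

/-- An integrable function integrated against the centred signal over `[0, t]` is small,
uniformly in `t ∈ [0, T]`, once the cycle is short. -/
lemma exists_forall_abs_integral_mul_uOnOff_sub_le {f : ℝ → ℝ} {T : ℝ} (hT : 0 ≤ T)
    (hf : IntegrableOn f (Set.Icc 0 T)) (hη : η ∈ Set.Ioo (0 : ℝ) 1) {ε : ℝ} (hε : 0 < ε) :
    ∃ δ > 0, ∀ Δ, 0 < Δ → Δ < δ → ∀ t ∈ Set.Icc 0 T,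
      |∫ τ in (0 : ℝ)..t, f τ * (uOnOff Δ η τ - η)| ≤ ε := by
  obtain ⟨g, -, hg, hfg⟩ := (memLp_one_iff_integrable.2 hf).exist_eLpNorm_sub_le
    ENNReal.one_ne_top le_rfl (half_pos hε)
  have hg1 : ContDiff ℝ 1 g := hg.of_le (by exact_mod_cast le_top)
  have hgi : IntegrableOn g (Set.Icc 0 T) := hg.continuous.continuousOn.integrableOn_Icc
  have hsub : IntegrableOn (fun x => f x - g x) (Set.Icc 0 T) := hf.sub hgi
  have habs : IntegrableOn (fun x => |f x - g x|) (Set.Icc 0 T) := hsub.abs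
  have hL1 : ∫ x in Set.Icc 0 T, |f x - g x| ≤ ε / 2 := by
    rw [eLpNorm_one_eq_lintegral_enorm] at hfg
    have h := ofReal_integral_norm_eq_lintegral_enorm hsub
    exact (ENNReal.ofReal_le_ofReal_iff (half_pos hε).le).1 (h.trans_le hfg)
  obtain ⟨C₁, hC₁⟩ := isCompact_Icc.exists_bound_of_continuousOn
    (s := Set.Icc 0 T) hg.continuous.continuousOn
  obtain ⟨C₂, hC₂⟩ := isCompact_Icc.exists_bound_of_continuousOn
    (s := Set.Icc 0 T) (hg1.continuous_deriv le_rfl).continuousOn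
  set C := max 1 (max C₁ C₂)
  have hC : 0 < C := lt_max_of_lt_left one_pos
  have hCT : 0 < C * (1 + T) := by positivity
  refine ⟨ε / 2 / (C * (1 + T)), by positivity, fun Δ hΔ hΔδ t ht => ?_⟩
  have hmem : Set.Icc 0 t ⊆ Set.Icc 0 T := Set.Icc_subset_Icc_right ht.2
  have hsmooth : |∫ τ in (0 : ℝ)..t, g τ * (uOnOff Δ η τ - η)| ≤ ε / 2 := by
    refine (abs_integral_mul_uOnOff_sub_le_of_contDiff hg1 (C := C) ht.1
      (fun x hx => (hC₁ x (hmem hx)).trans ?_) (fun x hx => (hC₂ x (hmem hx)).trans ?_)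
      hΔ hη).trans ?_
    · exact (le_max_left _ _).trans (le_max_right _ _)
    · exact (le_max_right _ _).trans (le_max_right _ _)
    · rw [lt_div_iff₀ hCT] at hΔδ
      calc C * (1 + t) * Δ ≤ C * (1 + T) * Δ := by gcongr; exact ht.2
        _ ≤ ε / 2 := by linarith
  have hdiff : |∫ τ in (0 : ℝ)..t, (f τ - g τ) * (uOnOff Δ η τ - η)| ≤ ε / 2 := by
    calc _ ≤ ∫ τ in (0 : ℝ)..t, |f τ - g τ| := by
          rw [← Real.norm_eq_abs]
          refine intervalIntegral.norm_integral_le_of_norm_le ht.1 (ae_of_all _ fun x _ => ?_)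
            (habs.intervalIntegrable_of_mem_Icc ht)
          rw [norm_mul]
          exact mul_le_of_le_one_right (norm_nonneg _) (abs_uOnOff_sub_le_one hη)
      _ ≤ ∫ x in Set.Icc 0 T, |f x - g x| := by
          rw [intervalIntegral.integral_of_le ht.1]
          exact setIntegral_mono_set habs (ae_of_all _ fun x => abs_nonneg _)
            (Set.Ioc_subset_Icc_self.trans hmem).eventuallyLE
      _ ≤ ε / 2 := hL1
  have hsplit : ∫ τ in (0 : ℝ)..t, f τ * (uOnOff Δ η τ - η) =
      (∫ τ in (0 : ℝ)..t, (f τ - g τ) * (uOnOff Δ η τ - η)) +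
        ∫ τ in (0 : ℝ)..t, g τ * (uOnOff Δ η τ - η) := by
    rw [← intervalIntegral.integral_add (hsub.mul_uOnOff_sub.intervalIntegrable_of_mem_Icc ht)
      (hgi.mul_uOnOff_sub.intervalIntegrable_of_mem_Icc ht)]
    congr 1 with τ
    ring
  rw [hsplit]
  exact (abs_add_le _ _).trans (by linarith)

end OnOffSignal

/-- If the effective supplies `S_n` converge uniformly on `[0,T]` to an integrable limit
supply `S*` and the signal cycles `Δ_n → 0`, then the on-and-off downstream boundary
conditions `∫₀ᵗ S_n u_{Δ_n}` converge, uniformly in `t ∈ [0,T]`, to the continuum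
downstream boundary condition `η ∫₀ᵗ S*`. -/
theorem onOff_boundary_tendsto_continuum (η T : ℝ) (hη : η ∈ Set.Ioo (0:ℝ) 1)
    (hT : 0 < T)
    (Sstar : ℝ → ℝ) (hSstar : IntegrableOn Sstar (Set.Icc 0 T))
    (Δ : ℕ → ℝ) (hΔpos : ∀ n, 0 < Δ n) (hΔ : Tendsto Δ atTop (nhds 0))
    (S : ℕ → ℝ → ℝ) (hSmeas : ∀ n, Measurable (S n))
    (hSconv : TendstoUniformlyOn S Sstar atTop (Set.Icc 0 T)) :
    Tendsto (fun n : ℕ => ⨆ t : Set.Icc (0:ℝ) T,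
        |(∫ τ in (0:ℝ)..(t:ℝ), S n τ * uOnOff (Δ n) η τ) -
          η * ∫ τ in (0:ℝ)..(t:ℝ), Sstar τ|)
      atTop (nhds 0) := by
  rw [Metric.tendsto_nhds]
  intro ε hε
  have hT1 : 0 < T + 1 := by linarith
  have hε' : 0 < ε / 4 / (T + 1) := by positivity
  obtain ⟨δ, hδ, hsmall⟩ :=
    exists_forall_abs_integral_mul_uOnOff_sub_le hT.le hSstar hη (show 0 < ε / 4 by positivity)
  filter_upwards [hΔ.eventually_lt_const hδ,
    Metric.tendstoUniformlyOn_iff.1 hSconv _ hε'] with n hn hSn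
  have hdist : ∀ τ ∈ Set.Icc 0 T, |S n τ - Sstar τ| ≤ ε / 4 / (T + 1) := fun τ hτ => by
    rw [← Real.dist_eq, dist_comm]
    exact (hSn τ hτ).le
  have hsub : IntegrableOn (fun τ => S n τ - Sstar τ) (Set.Icc 0 T) :=
    Integrable.of_bound ((hSmeas n).aestronglyMeasurable.sub hSstar.aestronglyMeasurable)
      (ε / 4 / (T + 1)) ((ae_restrict_iff' measurableSet_Icc).2 (ae_of_all _ hdist))
  have key : ∀ t : Set.Icc (0 : ℝ) T,
      |(∫ τ in (0:ℝ)..(t:ℝ), S n τ * uOnOff (Δ n) η τ) -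
        η * ∫ τ in (0:ℝ)..(t:ℝ), Sstar τ| ≤ ε / 2 := by
    rintro ⟨t, ht⟩
    have hsplit : (∫ τ in (0:ℝ)..t, S n τ * uOnOff (Δ n) η τ) - η * ∫ τ in (0:ℝ)..t, Sstar τ =
        (∫ τ in (0:ℝ)..t, (S n τ - Sstar τ) * uOnOff (Δ n) η τ) +
          ∫ τ in (0:ℝ)..t, Sstar τ * (uOnOff (Δ n) η τ - η) := by
      have h₁ := (hsub.mul_uOnOff (Δ := Δ n) (η := η)).intervalIntegrable_of_mem_Icc ht
      have h₂ := (hSstar.mul_uOnOff (Δ := Δ n) (η := η)).intervalIntegrable_of_mem_Icc ht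
      have h₃ := (hSstar.intervalIntegrable_of_mem_Icc ht).mul_const η
      simp only [mul_sub]
      rw [intervalIntegral.integral_sub h₂ h₃, ← add_sub_assoc,
        ← intervalIntegral.integral_add h₁ h₂, intervalIntegral.integral_mul_const, mul_comm η]
      congr 2 with τ
      ring
    have hfirst : |∫ τ in (0:ℝ)..t, (S n τ - Sstar τ) * uOnOff (Δ n) η τ| ≤ ε / 4 := by
      calc _ ≤ ε / 4 / (T + 1) * |t - 0| := by
            rw [← Real.norm_eq_abs]
            refine intervalIntegral.norm_integral_le_of_norm_le_const fun τ hτ => ?_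
            rw [Set.uIoc_of_le ht.1] at hτ
            rw [norm_mul]
            exact (mul_le_of_le_one_right (norm_nonneg _) abs_uOnOff_le_one).trans
              (hdist τ ⟨hτ.1.le, hτ.2.trans ht.2⟩)
        _ ≤ ε / 4 / (T + 1) * (T + 1) := by
            rw [sub_zero, abs_of_nonneg ht.1]
            gcongr
            linarith [ht.2]
        _ = ε / 4 := div_mul_cancel₀ _ hT1.ne'
    rw [hsplit]
    exact (abs_add_le _ _).trans (by linarith [hsmall (Δ n) (hΔpos n) hn t ht])
  rw [Real.dist_eq, sub_zero, abs_of_nonneg (Real.iSup_nonneg fun _ => abs_nonneg _)]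
  exact (Real.iSup_le key (by positivity)).trans_lt (by linarith)
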